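/- Let G be a countable infinite amenable group, P a polyhedron, X ⊆ P^G a closed subshift, and π_E : P^G → P^E the projection for E ⊆ G. Suppose there exist x' ∈ X and J ⊆ G such that every x ∈ P^G with π_{G∖J}(x) = π_{G∖J}(x') belongs to X. Then mdim(X, G) ≥ δ(J) · dim(P), where δ(J) is the upper Banach density of J. -/

import Mathlib

open Filter Topology Pointwise ENNReal

/-- A Følner sequence for a group `G`. -/
def IsFolnerSeq (G : Type*) [Group G] (F : ℕ → Finset G) : Prop :=
  (∀ n, (F n).Nonempty) ∧
    ∀ g : G, Filter.Tendsto
      (fun n => ((symmDiff (g • ((F n) : Set G)) ((F n) : Set G)).ncard : ℝ) / (F n).card)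
      Filter.atTop (nhds 0)

/-- A group is amenable if it admits a Følner sequence. -/
def IsAmenable (G : Type*) [Group G] : Prop := ∃ F : ℕ → Finset G, IsFolnerSeq G F

variable {G : Type*} [Group G]

/-- The `K`-boundary of a finite set `A`. -/
def kBoundary (A K : Finset G) : Set G :=
  {g : G | (∃ k ∈ K, k * g ∈ A) ∧ ∃ k ∈ K, k * g ∉ A}

/-- `A` is `(K, δ)`-invariant. -/
def InvariantSet (A K : Finset G) (δ : ℝ) : Prop :=
  ((kBoundary A K).ncard : ℝ) < δ * A.card

/-- A subset of a group is syndetic if finitely many translates cover the group. -/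
def Syndetic (A : Set G) : Prop := ∃ F : Finset G, (F : Set G) * A = Set.univ

/-- A finite tiling of a group `G`: a partition of `G` into right translates of
finitely many finite shapes, each shape containing the identity. -/
structure FiniteTiling (G : Type*) [Group G] where
  tiles : Set (Set G)
  shapes : Finset (Finset G)
  covers : ∀ g : G, ∃! t, t ∈ tiles ∧ g ∈ t
  tile_shape : ∀ t ∈ tiles, ∃ S ∈ shapes, ∃ c : G, t = (S : Set G) * {c}
  one_mem_shape : ∀ S ∈ shapes, (1 : G) ∈ S

/-- The set of centers of a shape `S` in a tiling. -/
def FiniteTiling.center (T : FiniteTiling G) (S : Finset G) : Set G :=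
  {c : G | ((S : Set G) * {c}) ∈ T.tiles}

/-- A finite tiling is irreducible if every sufficiently invariant finite set
contains a tile of every shape. -/
def FiniteTiling.IsIrreducible (T : FiniteTiling G) : Prop :=
  ∃ (T₀ : Finset G) (ε : ℝ), 0 < ε ∧
    ∀ F : Finset G, InvariantSet F T₀ ε →
      ∀ S ∈ T.shapes, ∃ c ∈ T.center S, (S : Set G) * {c} ⊆ (F : Set G)

/-- The shift action of `G` on `A^G`: `(c • x) g = x (g * c)`. -/
def shiftAct {A : Type*} (c : G) (x : G → A) : G → A := fun g => x (g * c)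

instance : TopologicalSpace (Option (Finset G)) := ⊥

open Classical in
/-- The point of `(S(T) ∪ {0})^G` encoding the centers of a tiling. -/
noncomputable def FiniteTiling.point (T : FiniteTiling G) : G → Option (Finset G) :=
  fun g => if h : ∃ S, S ∈ T.shapes ∧ g ∈ T.center S then some h.choose else none

/-- The subshift associated with a finite tiling: the orbit closure of `T.point`. -/
noncomputable def FiniteTiling.subshift (T : FiniteTiling G) : Set (G → Option (Finset G)) :=
  closure (Set.range fun c : G => shiftAct c T.point)

/-- `T₂` is primely congruent with `T₁`: tiles of `T₂` are unions of tiles of `T₁`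
and each shape of `T₂` has a unique master partition by tiles of `T₁`. -/
def PrimelyCongruent (T₁ T₂ : FiniteTiling G) : Prop :=
  (∀ t₁ ∈ T₁.tiles, ∀ t₂ ∈ T₂.tiles, (t₁ ∩ t₂).Nonempty → t₁ ⊆ t₂) ∧
  ∀ S ∈ T₂.shapes, ∀ c c' : G, c ∈ T₂.center S → c' ∈ T₂.center S →
    {u : Set G | ∃ t ∈ T₁.tiles, t ⊆ (S : Set G) * {c} ∧ u = t * {c⁻¹}} =
    {u : Set G | ∃ t ∈ T₁.tiles, t ⊆ (S : Set G) * {c'} ∧ u = t * {c'⁻¹}}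

/-- Number of patterns of a subshift on a finite window `F`. -/
noncomputable def patternCount {A : Type*} (X : Set (G → A)) (F : Finset G) : ℕ :=
  {p : ↑F → A | ∃ x ∈ X, ∀ g : ↑F, x (g : G) = p g}.ncard

section Dim

variable {Y : Type*} [TopologicalSpace Y]

/-- `β` is a finite open cover of the set `X`. -/
def IsOpenCoverOf (X : Set Y) (β : Finset (Set Y)) : Prop :=
  (∀ U ∈ β, IsOpen U) ∧ X ⊆ ⋃ U ∈ β, U

/-- The order of a finite cover on a set `X`. -/
noncomputable def ordOn (X : Set Y) (β : Finset (Set Y)) : ℕ :=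
  ⨆ y : X, ({U : Set Y | U ∈ β ∧ (y : Y) ∈ U}.ncard - 1)

/-- `D(α)`: minimal order among finite open covers of `X` refining `α`. -/
noncomputable def Dcov (X : Set Y) (α : Finset (Set Y)) : ℕ :=
  sInf {n | ∃ β : Finset (Set Y), IsOpenCoverOf X β ∧
    (∀ U ∈ β, ∃ V ∈ α, U ⊆ V) ∧ ordOn X β = n}

/-- The topological (covering) dimension of a subset `X` of a topological space. -/
noncomputable def topDim (X : Set Y) : ℕ∞ :=
  ⨆ α ∈ {α : Finset (Set Y) | IsOpenCoverOf X α}, (Dcov X α : ℕ∞)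

/-- The join `⋁_{g ∈ F} (σ g)⁻¹ α` of the pullbacks of a finite cover along an action. -/
noncomputable def FCover {H : Type*} (σ : H → Y → Y) (F : Finset H) (α : Finset (Set Y)) :
    Finset (Set Y) :=
  letI := Classical.decEq H
  letI := Classical.decEq (Set Y)
  (F.pi fun _ => α).image fun f => ⋂ g, ⋂ (h : g ∈ F), σ g ⁻¹' f g h

/-- Mean topological dimension of `X` with respect to an action `σ` of `G`,
computed along the Følner sequence `Fo`. -/
noncomputable def mdim {H : Type*} (σ : H → Y → Y) (X : Set Y) (Fo : ℕ → Finset H) : ℝ≥0∞ :=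
  ⨆ α ∈ {α : Finset (Set Y) | IsOpenCoverOf X α},
    Filter.limsup
      (fun n => (Dcov X (FCover σ (Fo n) α) : ℝ≥0∞) / ((Fo n).card : ℝ≥0∞))
      Filter.atTop

end Dim

/-- A polyhedron: a finite union of simplices (convex hulls of finite sets) in a
Euclidean space. -/
def IsPolyhedron {N : ℕ} (P : Set (EuclideanSpace ℝ (Fin N))) : Prop :=
  ∃ S : Finset (Finset (EuclideanSpace ℝ (Fin N))),
    P = ⋃ s ∈ S, convexHull ℝ (s : Set (EuclideanSpace ℝ (Fin N)))

/-- The upper (Banach) density of a subset of an amenable group. -/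
noncomputable def upperDensity (G : Type*) [Group G] (J : Set G) : ℝ :=
  sSup {r : ℝ | ∃ Fo : ℕ → Finset G, IsFolnerSeq G Fo ∧
    r = Filter.limsup (fun n => ((J ∩ (Fo n : Set G)).ncard : ℝ) / (Fo n).card) Filter.atTop}


/-- The `k`-th vertex of the Kuhn simplex with base point `v` in which the coordinate `i` is
increased at step `τ i`. -/
def kuhnVertex {n : ℕ} (v : Fin n → ℕ) (τ : Equiv.Perm (Fin n)) (k : ℕ) : Fin n → ℕ :=
  fun i => v i + if (τ i : ℕ) < k then 1 else 0

/-- A sequence of labels is full iff an odd number of its facets carries exactly the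
nonzero labels. -/
lemma full_eq_sum_facets (n : ℕ) (a : ℕ → ℕ) (ha : ∀ k ∈ Finset.range (n + 1), a k ≤ n) :
    (if (Finset.range (n + 1)).image a = Finset.range (n + 1) then 1 else 0 : ZMod 2) =
      ∑ k ∈ Finset.range (n + 1),
        if ((Finset.range (n + 1)).erase k).image a = Finset.Icc 1 n then 1 else 0 := by
  set R := Finset.range (n + 1) with hR
  have hcard : R.card = n + 1 := by simp [hR]
  rw [← Finset.sum_filter]
  by_cases hfull : R.image a = R
  · have hinj : Set.InjOn a R := by
      rw [← Finset.card_image_iff, hfull]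
    obtain ⟨k₀, hk₀, hak₀⟩ : ∃ k ∈ R, a k = 0 := by
      have : 0 ∈ R.image a := by rw [hfull]; simp [hR]
      simpa using this
    have hfil : R.filter (fun k => (R.erase k).image a = Finset.Icc 1 n) = {k₀} := by
      ext k
      simp only [Finset.mem_filter, Finset.mem_singleton]
      constructor
      · rintro ⟨hk, h⟩
        by_contra hne
        have : a k₀ ∈ (R.erase k).image a :=
          Finset.mem_image_of_mem _ (Finset.mem_erase.2 ⟨fun h => hne h.symm, hk₀⟩)
        rw [h, hak₀] at this
        simp at this
      · rintro rfl
        refine ⟨hk₀, ?_⟩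
        ext j
        constructor
        · intro hj
          obtain ⟨l, hl, rfl⟩ := Finset.mem_image.1 hj
          obtain ⟨hlk, hlR⟩ := Finset.mem_erase.1 hl
          have : a l ≠ 0 := fun h0 => hlk (hinj hlR hk₀ (h0.trans hak₀.symm))
          have := ha l hlR
          simp; omega
        · intro hj
          have hjR : j ∈ R.image a := by rw [hfull]; simp [hR] at hj ⊢; omega
          obtain ⟨l, hl, rfl⟩ := Finset.mem_image.1 hjR
          refine Finset.mem_image_of_mem _ (Finset.mem_erase.2 ⟨?_, hl⟩)
          rintro rfl
          simp [hak₀] at hj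
    rw [if_pos hfull, hfil, Finset.sum_singleton]
  · rw [if_neg hfull]
    by_cases hex : ∃ k ∈ R, (R.erase k).image a = Finset.Icc 1 n
    · obtain ⟨k, hk, hkim⟩ := hex
      have hak : a k ∈ Finset.Icc 1 n := by
        have h1 := ha k hk
        rw [Finset.mem_Icc]
        refine ⟨?_, h1⟩
        by_contra h0
        apply hfull
        have him : R.image a = insert (a k) ((R.erase k).image a) := by
          rw [← Finset.image_insert, Finset.insert_erase hk]
        rw [him, hkim]
        ext j
        simp only [Finset.mem_insert, Finset.mem_Icc, hR, Finset.mem_range]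
        omega
      have hinj : Set.InjOn a (R.erase k) := by
        rw [← Finset.card_image_iff, hkim, Finset.card_erase_of_mem hk]; simp [hcard]
      obtain ⟨k', hk', hakk'⟩ := Finset.mem_image.1 (hkim ▸ hak)
      obtain ⟨hk'k, hk'R⟩ := Finset.mem_erase.1 hk'
      have hfil : R.filter (fun k => (R.erase k).image a = Finset.Icc 1 n) = {k, k'} := by
        ext j
        simp only [Finset.mem_filter, Finset.mem_insert, Finset.mem_singleton]
        constructor
        · rintro ⟨hj, hjim⟩
          by_contra! hne
          have h1 : a j ∈ (R.erase j).image a := by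
            rw [hjim, ← hkim]
            exact Finset.mem_image_of_mem _ (Finset.mem_erase.2 ⟨hne.1, hj⟩)
          obtain ⟨l, hl, hlj⟩ := Finset.mem_image.1 h1
          obtain ⟨hlj', hlR⟩ := Finset.mem_erase.1 hl
          have hjk : j ∈ (R.erase k : Finset ℕ) := Finset.mem_erase.2 ⟨hne.1, hj⟩
          by_cases hlk : l = k
          · subst hlk
            exact hne.2 (hinj hjk hk' (hlj.symm.trans hakk'.symm))
          · exact hlj' (hinj (Finset.mem_coe.2 (Finset.mem_erase.2 ⟨hlk, hlR⟩)) hjk hlj)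
        · rintro (rfl | rfl)
          · exact ⟨hk, hkim⟩
          · refine ⟨hk'R, ?_⟩
            rw [← hkim]
            ext y
            simp only [Finset.mem_image, Finset.mem_erase]
            constructor
            · rintro ⟨l, ⟨hl, hlR⟩, rfl⟩
              by_cases hlk : l = k
              · exact ⟨j, ⟨hk'k, hk'R⟩, by rw [hlk, hakk']⟩
              · exact ⟨l, ⟨hlk, hlR⟩, rfl⟩
            · rintro ⟨l, ⟨hl, hlR⟩, rfl⟩
              by_cases hlk : l = j
              · exact ⟨k, ⟨fun h => hk'k h.symm, hk⟩, by rw [hlk, hakk']⟩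
              · exact ⟨l, ⟨hlk, hlR⟩, rfl⟩
      rw [hfil, Finset.sum_pair (fun h => hk'k h.symm)]
      decide
    · rw [Finset.filter_false_of_mem (by simpa using hex), Finset.sum_empty]
      
lemma sum_facet_middle {n : ℕ} (ℓ : (Fin (n + 1) → ℕ) → ℕ) (v : Fin (n + 1) → ℕ) (A : Finset ℕ)
    (k : ℕ) (hk : k ∈ Finset.Ico 1 (n + 1)) :
    ∑ τ : Equiv.Perm (Fin (n + 1)),
      (if ((Finset.range (n + 2)).erase k).image (fun j => ℓ (kuhnVertex v τ j)) = A
        then 1 else 0 : ZMod 2) = 0 := by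
  rw [Finset.mem_Ico] at hk
  let p : Fin (n + 1) := ⟨k - 1, by omega⟩
  let q : Fin (n + 1) := ⟨k, by omega⟩
  have hpq : p ≠ q := by simp [p, q, Fin.ext_iff]; omega
  refine Finset.sum_involution (fun τ _ => Equiv.swap p q * τ) ?_ ?_ (by simp) ?_
  · intro τ _
    have : ((Finset.range (n + 2)).erase k).image
        (fun j => ℓ (kuhnVertex v (Equiv.swap p q * τ) j)) =
        ((Finset.range (n + 2)).erase k).image (fun j => ℓ (kuhnVertex v τ j)) := by
      refine Finset.image_congr fun j hj => ?_
      have hjk : j ≠ k := (Finset.mem_erase.1 hj).1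
      congr 1
      funext i
      simp only [kuhnVertex, Equiv.Perm.mul_apply, Equiv.swap_apply_def]
      congr 1
      refine if_congr ?_ rfl rfl
      split_ifs with h1 h2
      · simp [h1, p, q]; omega
      · simp [h2, p, q]; omega
      · rfl
    rw [this]
    exact CharTwo.add_self_eq_zero _
  · intro τ _ _ h
    have := congrArg (fun σ => σ (τ.symm p)) h
    simp at this
    exact hpq this.symm
  · intro τ _
    simp [← mul_assoc]

lemma kuhnVertex_rotate {n : ℕ} (v : Fin (n + 1) → ℕ) (τ : Equiv.Perm (Fin (n + 1))) (j : ℕ)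
    (hj : j ≤ n) :
    kuhnVertex (v + Pi.single (τ.symm 0) 1) ((finRotate (n + 1)).symm * τ) j =
      kuhnVertex v τ (j + 1) := by
  funext i
  by_cases hi : τ i = 0
  · have hi' : τ.symm 0 = i := by rw [← hi]; simp
    have : ((finRotate (n + 1)).symm * τ) i = Fin.last n := by
      rw [Equiv.Perm.mul_apply, Equiv.symm_apply_eq, finRotate_last, hi]
    simp only [kuhnVertex, Pi.add_apply, this, hi, hi']
    simp; omega
  · have hi' : i ≠ τ.symm 0 := by rintro rfl; simp at hi
    obtain ⟨m, hm⟩ := Fin.exists_succ_eq.2 hi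
    have : ((finRotate (n + 1)).symm * τ) i = m.castSucc := by
      rw [Equiv.Perm.mul_apply, Equiv.symm_apply_eq, ← hm]; simp
    simp only [kuhnVertex, Pi.add_apply, this, ← hm]
    simp [hi']

/-- The box `{0, …, m}^n` of base points. -/
def baseBox (n m : ℕ) : Finset (Fin n → ℕ) := Fintype.piFinset fun _ => Finset.range (m + 1)

lemma mem_baseBox {n m : ℕ} {v : Fin n → ℕ} : v ∈ baseBox n m ↔ ∀ i, v i ≤ m := by
  simp [baseBox]

lemma kuhnVertex_le {n m : ℕ} {v : Fin n → ℕ} (hv : v ∈ baseBox n m)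
    (τ : Equiv.Perm (Fin n)) (k : ℕ) (i : Fin n) : kuhnVertex v τ k i ≤ m + 1 := by
  have := mem_baseBox.1 hv i
  simp only [kuhnVertex]
  split_ifs <;> omega

lemma sum_shift_add_sum {n m : ℕ} (i : Fin n) (E : (Fin n → ℕ) → ZMod 2)
    (hE : ∀ v ∈ baseBox n m, v i = 0 → E v = 0) :
    ∑ v ∈ baseBox n m, E (v + Pi.single i 1) + ∑ v ∈ baseBox n m, E v =
      ∑ v ∈ (baseBox n m).filter (fun v => v i = m), E (v + Pi.single i 1) := by
  have key : ∑ v ∈ (baseBox n m).filter (fun v => ¬ v i = m), E (v + Pi.single i 1) =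
      ∑ v ∈ (baseBox n m).filter (fun v => ¬ v i = 0), E v := by
    refine Finset.sum_bij' (fun v _ => v + Pi.single i 1) (fun v _ => v - Pi.single i 1)
      ?_ ?_ ?_ ?_ ?_
    · intro v hv
      simp only [Finset.mem_filter, mem_baseBox] at hv ⊢
      refine ⟨fun j => ?_, by simp⟩
      have h1 := hv.1 j
      by_cases hj : j = i
      · subst hj; have := hv.2; simp; omega
      · simpa [hj] using h1
    · intro v hv
      simp only [Finset.mem_filter, mem_baseBox] at hv ⊢
      refine ⟨fun j => ?_, ?_⟩
      · have h1 := hv.1 j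
        simp only [Pi.sub_apply]; omega
      · have h1 := hv.1 i
        have := hv.2
        simp; omega
    · intro v hv
      funext j
      simp
    · intro v hv
      simp only [Finset.mem_filter] at hv
      funext j
      by_cases hj : j = i
      · subst hj; simp; omega
      · simp [hj]
    · intro v hv; rfl
  have h0 : ∑ v ∈ (baseBox n m).filter (fun v => v i = 0), E v = 0 :=
    Finset.sum_eq_zero fun v hv => hE v (Finset.mem_filter.1 hv).1 (Finset.mem_filter.1 hv).2
  rw [← Finset.sum_filter_add_sum_filter_not (baseBox n m) (fun v => v i = m),
    ← Finset.sum_filter_add_sum_filter_not (baseBox n m) (fun v => v i = 0) E, key, h0, zero_add,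
    add_assoc, CharTwo.add_self_eq_zero, add_zero]

lemma kuhnVertex_cons {n : ℕ} (m : ℕ) (w : Fin n → ℕ) (e : Equiv.Perm (Fin n)) (k : ℕ) :
    kuhnVertex (Fin.cons m w : Fin (n + 1) → ℕ) (Equiv.Perm.decomposeFin.symm (0, e)) (k + 1) =
      Fin.cons (m + 1) (kuhnVertex w e k) := by
  funext i
  refine Fin.cases ?_ (fun i => ?_) i
  · simp [kuhnVertex]
  · simp only [kuhnVertex, Equiv.Perm.decomposeFin_symm_apply_succ]
    simp [kuhnVertex]

/-- **Sperner's lemma** for the Kuhn triangulation of a cube. -/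
theorem sum_full_kuhn_simplices (n m : ℕ) (ℓ : (Fin n → ℕ) → ℕ)
    (hle : ∀ v, (∀ i, v i ≤ m + 1) → ℓ v ≤ n)
    (hzero : ∀ v, (∀ i, v i ≤ m + 1) → ∀ i : Fin n, v i = 0 → ℓ v ≤ i)
    (htop : ∀ v, (∀ i, v i ≤ m + 1) → ∀ i : Fin n, v i = m + 1 → ℓ v ≠ i) :
    ∑ τ : Equiv.Perm (Fin n), ∑ v ∈ baseBox n m,
      (if (Finset.range (n + 1)).image (fun k => ℓ (kuhnVertex v τ k)) = Finset.range (n + 1)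
        then 1 else 0 : ZMod 2) = 1 := by
  induction n with
  | zero =>
    have h0 : ∀ v, ℓ v = 0 := fun v => Nat.le_zero.1 (hle v (fun i => i.elim0))
    simp [h0, baseBox]
  | succ n ih =>
    set A := Finset.Icc 1 (n + 1) with hA
    let D : Equiv.Perm (Fin (n + 1)) → (Fin (n + 1) → ℕ) → ℕ → ZMod 2 := fun τ v k =>
      if ((Finset.range (n + 2)).erase k).image (fun j => ℓ (kuhnVertex v τ j)) = A then 1 else 0
    have h1 : ∀ τ : Equiv.Perm (Fin (n + 1)), ∀ v ∈ baseBox (n + 1) m,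
        (if (Finset.range (n + 2)).image (fun k => ℓ (kuhnVertex v τ k)) = Finset.range (n + 2)
          then 1 else 0 : ZMod 2) = ∑ k ∈ Finset.range (n + 2), D τ v k := fun τ v hv =>
      full_eq_sum_facets (n + 1) (fun k => ℓ (kuhnVertex v τ k))
        fun k _ => hle _ (kuhnVertex_le hv τ k)
    rw [Finset.sum_congr rfl fun τ _ => Finset.sum_congr rfl (h1 τ)]
    have hmid : ∀ k ∈ Finset.Ico 1 (n + 1),
        ∑ τ : Equiv.Perm (Fin (n + 1)), ∑ v ∈ baseBox (n + 1) m, D τ v k = 0 := by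
      intro k hk
      rw [Finset.sum_comm]
      exact Finset.sum_eq_zero fun v _ => sum_facet_middle ℓ v A k hk
    let ρ : Equiv.Perm (Fin (n + 1)) := (finRotate (n + 1)).symm
    have hrot : ∀ τ v, D τ v 0 = D (ρ * τ) (v + Pi.single (τ.symm 0) 1) (n + 1) := by
      intro τ v
      have : ((Finset.range (n + 2)).erase 0).image (fun j => ℓ (kuhnVertex v τ j)) =
          ((Finset.range (n + 2)).erase (n + 1)).image
            (fun j => ℓ (kuhnVertex (v + Pi.single (τ.symm 0) 1) (ρ * τ) j)) := by
        ext y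
        simp only [Finset.mem_image, Finset.mem_erase, Finset.mem_range]
        constructor
        · rintro ⟨j, hj, rfl⟩
          refine ⟨j - 1, by omega, ?_⟩
          rw [kuhnVertex_rotate _ _ _ (by omega), Nat.sub_add_cancel (by omega)]
        · rintro ⟨j, hj, rfl⟩
          exact ⟨j + 1, by omega, by rw [kuhnVertex_rotate _ _ _ (by omega)]⟩
      simp only [D, this]
    have hends : ∀ τ : Equiv.Perm (Fin (n + 1)),
        ∑ v ∈ baseBox (n + 1) m, D τ v 0 + ∑ v ∈ baseBox (n + 1) m, D (ρ * τ) v (n + 1) =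
        ∑ v ∈ (baseBox (n + 1) m).filter (fun v => v (τ.symm 0) = m), D τ v 0 := by
      intro τ
      simp only [hrot τ]
      apply sum_shift_add_sum (τ.symm 0) (fun v => D (ρ * τ) v (n + 1))
      intro v hv hv0
      have hlast : (ρ * τ) (τ.symm 0) = Fin.last n := by
        simp only [ρ, Equiv.Perm.mul_apply, Equiv.apply_symm_apply]
        rw [Equiv.symm_apply_eq, finRotate_last]
      refine if_neg fun h => ?_
      have hmem : n + 1 ∈ A := by simp [A]
      rw [← h] at hmem
      obtain ⟨j, hj, hjn⟩ := Finset.mem_image.1 hmem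
      simp only [Finset.mem_erase, Finset.mem_range] at hj
      have hz := hzero _ (kuhnVertex_le hv (ρ * τ) j) (τ.symm 0) (by
        simp only [kuhnVertex, hlast, hv0]; simp; omega)
      have := (τ.symm 0).isLt
      omega
    have hside : ∀ τ : Equiv.Perm (Fin (n + 1)), τ.symm 0 ≠ 0 →
        ∑ v ∈ (baseBox (n + 1) m).filter (fun v => v (τ.symm 0) = m), D τ v 0 = 0 := by
      intro τ hτ
      refine Finset.sum_eq_zero fun v hv => if_neg fun h => ?_
      obtain ⟨hv, hvm⟩ := Finset.mem_filter.1 hv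
      have hmem : (τ.symm 0 : ℕ) ∈ A := by
        have := (τ.symm 0).isLt
        have : (τ.symm 0 : ℕ) ≠ 0 := fun h => hτ (Fin.ext h)
        simp only [A, Finset.mem_Icc]; omega
      rw [← h] at hmem
      obtain ⟨j, hj, hjn⟩ := Finset.mem_image.1 hmem
      simp only [Finset.mem_erase, Finset.mem_range] at hj
      refine htop _ (kuhnVertex_le hv τ j) (τ.symm 0) ?_ hjn
      simp only [kuhnVertex, hvm, Equiv.apply_symm_apply]
      rw [if_pos (by simp; omega)]
    have hlow := ih (fun w => ℓ (Fin.cons (m + 1) w) - 1)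
      (fun w hw => by
        have := hle (Fin.cons (m + 1) w) (Fin.cases (by simp) (by simpa using hw))
        omega)
      (fun w hw i hi => by
        have := hzero (Fin.cons (m + 1) w) (Fin.cases (by simp) (by simpa using hw)) i.succ
          (by simpa using hi)
        simp at this; omega)
      (fun w hw i hi => by
        have h1 := htop (Fin.cons (m + 1) w) (Fin.cases (by simp) (by simpa using hw)) i.succ
          (by simpa using hi)
        have h2 := htop (Fin.cons (m + 1) w) (Fin.cases (by simp) (by simpa using hw)) 0
          (by simp)
        simp at h1 h2; omega)
    have hpos : ∀ w : Fin n → ℕ, (∀ i, w i ≤ m + 1) → 1 ≤ ℓ (Fin.cons (m + 1) w) := by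
      intro w hw
      have h2 := htop (Fin.cons (m + 1) w) (Fin.cases (by simp) (by simpa using hw)) 0
          (by simp)
      simp at h2; omega
    have hD : ∀ (e : Equiv.Perm (Fin n)), ∀ w ∈ baseBox n m,
        D (Equiv.Perm.decomposeFin.symm (0, e)) (Fin.cons m w) 0 =
        if (Finset.range (n + 1)).image (fun k => ℓ (Fin.cons (m + 1) (kuhnVertex w e k)) - 1) =
          Finset.range (n + 1) then 1 else 0 := by
      intro e w hw
      refine if_congr ?_ rfl rfl
      have hp := fun k => hpos _ (kuhnVertex_le hw e k)
      have e1 : ((Finset.range (n + 2)).erase 0).image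
          (fun j => ℓ (kuhnVertex (Fin.cons m w) (Equiv.Perm.decomposeFin.symm (0, e)) j)) =
          ((Finset.range (n + 1)).image
            (fun k => ℓ (Fin.cons (m + 1) (kuhnVertex w e k)) - 1)).image Nat.succ := by
        ext y
        simp only [Finset.mem_image, Finset.mem_erase, Finset.mem_range, exists_exists_and_eq_and]
        constructor
        · rintro ⟨j, hj, rfl⟩
          obtain ⟨k, rfl⟩ : ∃ k, j = k + 1 := ⟨j - 1, by omega⟩
          refine ⟨k, by omega, ?_⟩
          rw [kuhnVertex_cons, Nat.succ_eq_add_one, Nat.sub_add_cancel (hp k)]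
        · rintro ⟨k, hk, rfl⟩
          refine ⟨k + 1, by omega, ?_⟩
          rw [kuhnVertex_cons, Nat.succ_eq_add_one, Nat.sub_add_cancel (hp k)]
      have e2 : A = (Finset.range (n + 1)).image Nat.succ := by
        ext y
        simp only [A, Finset.mem_Icc, Finset.mem_image, Finset.mem_range]
        constructor
        · intro h; exact ⟨y - 1, by omega, by omega⟩
        · rintro ⟨k, hk, rfl⟩; omega
      rw [e1, e2, Finset.image_inj Nat.succ_injective]
    calc ∑ τ : Equiv.Perm (Fin (n + 1)), ∑ v ∈ baseBox (n + 1) m,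
          ∑ k ∈ Finset.range (n + 2), D τ v k
        = ∑ k ∈ Finset.range (n + 2), ∑ τ : Equiv.Perm (Fin (n + 1)),
            ∑ v ∈ baseBox (n + 1) m, D τ v k := by
          rw [Finset.sum_comm' (t' := Finset.univ) (s' := fun _ => Finset.range (n + 2)) (by simp)]
          refine Finset.sum_congr rfl fun τ _ => ?_
          rw [Finset.sum_comm]
      _ = ∑ τ : Equiv.Perm (Fin (n + 1)), ∑ v ∈ baseBox (n + 1) m, D τ v 0 +
          ∑ τ : Equiv.Perm (Fin (n + 1)), ∑ v ∈ baseBox (n + 1) m, D τ v (n + 1) := by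
          rw [Finset.sum_range_succ, Finset.range_eq_Ico,
            Finset.sum_eq_sum_Ico_succ_bot (Nat.succ_pos n), Finset.sum_eq_zero hmid, add_zero]
      _ = ∑ τ : Equiv.Perm (Fin (n + 1)), (∑ v ∈ baseBox (n + 1) m, D τ v 0 +
            ∑ v ∈ baseBox (n + 1) m, D (ρ * τ) v (n + 1)) := by
          rw [Finset.sum_add_distrib]
          congr 1
          exact (Equiv.sum_comp (Equiv.mulLeft ρ)
            (fun τ => ∑ v ∈ baseBox (n + 1) m, D τ v (n + 1))).symm
      _ = ∑ τ : Equiv.Perm (Fin (n + 1)),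
            ∑ v ∈ (baseBox (n + 1) m).filter (fun v => v (τ.symm 0) = m), D τ v 0 :=
          Finset.sum_congr rfl fun τ _ => hends τ
      _ = ∑ e : Equiv.Perm (Fin n), ∑ w ∈ baseBox n m,
            D (Equiv.Perm.decomposeFin.symm (0, e)) (Fin.cons m w) 0 := by
          rw [← Equiv.Perm.decomposeFin.symm.sum_comp, Fintype.sum_prod_type,
            Finset.sum_eq_single 0]
          · refine Finset.sum_congr rfl fun e _ => ?_
            have h0 : (Equiv.Perm.decomposeFin.symm ((0 : Fin (n + 1)), e)).symm 0 = 0 := by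
              rw [Equiv.symm_apply_eq]; simp
            rw [h0]
            refine Finset.sum_bij' (fun v _ => Fin.tail v) (fun w _ => Fin.cons m w) ?_ ?_ ?_ ?_ ?_
            · intro v hv
              simp only [Finset.mem_filter, mem_baseBox] at hv ⊢
              exact fun i => hv.1 i.succ
            · intro w hw
              simp only [Finset.mem_filter, mem_baseBox] at hw ⊢
              exact ⟨Fin.cases (by simp) (by simpa using hw), by simp⟩
            · intro v hv
              rw [← (Finset.mem_filter.1 hv).2]; simp
            · intro w hw; simp
            · intro v hv
              rw [← (Finset.mem_filter.1 hv).2]; simp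
          · intro p _ hp
            refine Finset.sum_eq_zero fun e _ => hside _ fun h => hp ?_
            rw [Equiv.symm_apply_eq] at h
            simpa using h.symm
          · simp
      _ = 1 := by
          rw [← hlow]
          exact Finset.sum_congr rfl fun e _ => Finset.sum_congr rfl (hD e)

lemma exists_full_kuhn_simplex (n m : ℕ) (ℓ : (Fin n → ℕ) → ℕ)
    (hle : ∀ v, (∀ i, v i ≤ m + 1) → ℓ v ≤ n)
    (hzero : ∀ v, (∀ i, v i ≤ m + 1) → ∀ i : Fin n, v i = 0 → ℓ v ≤ i)
    (htop : ∀ v, (∀ i, v i ≤ m + 1) → ∀ i : Fin n, v i = m + 1 → ℓ v ≠ i) :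
    ∃ τ : Equiv.Perm (Fin n), ∃ v ∈ baseBox n m,
      (Finset.range (n + 1)).image (fun k => ℓ (kuhnVertex v τ k)) = Finset.range (n + 1) := by
  by_contra! hcon
  have := sum_full_kuhn_simplices n m ℓ hle hzero htop
  rw [Finset.sum_eq_zero fun τ _ => Finset.sum_eq_zero fun v hv => if_neg (hcon τ v hv)] at this
  exact zero_ne_one this

/-- **Lebesgue's covering theorem**: a finite open cover of a cube none of whose members meets
two opposite faces has a point that lies in more members than the dimension of the cube. -/
theorem exists_mem_many_of_open_cover_cube_fin {κ : Type*} [Finite κ] {n : ℕ}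
    (W : κ → Set (Fin n → unitInterval)) (hW : ∀ c, IsOpen (W c)) (hcov : ⋃ c, W c = Set.univ)
    (hsep : ∀ c i, (∀ t ∈ W c, t i ≠ 0) ∨ (∀ t ∈ W c, t i ≠ 1)) :
    ∃ t, n + 1 ≤ {c | t ∈ W c}.ncard := by
  obtain ⟨C, hCcov, hCcl, hCW⟩ :=
    exists_iUnion_eq_closed_subset hW (fun _ => Set.toFinite _) hcov
  let N : (Fin n → unitInterval) → Set (Fin n → unitInterval) :=
    fun t => ⋂ c : {c // t ∉ C c}, (C c)ᶜ
  have hN : ∀ t, IsOpen (N t) := fun t => isOpen_iInter_of_finite fun c => (hCcl c).isOpen_compl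
  obtain ⟨δ, hδ, hball⟩ := lebesgue_number_lemma_of_metric
    (isCompact_univ : IsCompact (Set.univ : Set (Fin n → unitInterval))) hN
    (fun t _ => Set.mem_iUnion.2 ⟨t, Set.mem_iInter.2 fun c => c.2⟩)
  obtain ⟨m, hm⟩ := exists_nat_one_div_lt hδ
  let q : (Fin n → ℕ) → (Fin n → unitInterval) :=
    fun v i => Set.projIcc (0 : ℝ) 1 zero_le_one ((v i : ℝ) / (m + 1))
  have hm0 : (0 : ℝ) < m + 1 := by positivity
  have hcol : ∀ v, ∃ c, q v ∈ C c := fun v => by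
    have : q v ∈ ⋃ c, C c := by rw [hCcov]; trivial
    exact Set.mem_iUnion.1 this
  choose col hcol using hcol
  let S : κ → Set ℕ := fun c => {k | k = n ∨ ∃ i : Fin n, (i : ℕ) = k ∧ ∃ t ∈ W c, t i = 0}
  let lab : κ → ℕ := fun c => sInf (S c)
  have hlab : ∀ c, lab c ∈ S c := fun c => Nat.sInf_mem ⟨n, Or.inl rfl⟩
  obtain ⟨τ, v, hv, hfull⟩ := exists_full_kuhn_simplex n m (fun v => lab (col v))
    (fun v _ => Nat.sInf_le (Or.inl rfl))
    (fun v _ i hi => Nat.sInf_le (Or.inr ⟨i, rfl, q v, hCW _ (hcol v), by simp [q, hi]⟩))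
    (fun v _ i hi heq => by
      rcases hlab (col v) with h | ⟨j, hj, t, ht, ht0⟩
      · have := i.isLt
        omega
      · obtain rfl : j = i := Fin.ext (hj.trans heq)
        have h1 : q v j = 1 := by
          simp only [q, hi]
          apply Subtype.ext
          rw [Set.coe_projIcc]
          push_cast
          rw [div_self hm0.ne']
          simp
        rcases hsep (col v) j with h | h
        · exact h t ht ht0
        · exact h _ (hCW _ (hcol v)) h1)
  obtain ⟨t, ht⟩ := hball (q (kuhnVertex v τ 0)) trivial
  refine ⟨t, ?_⟩
  have hmem : ∀ k, t ∈ W (col (kuhnVertex v τ k)) := by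
    intro k
    refine hCW _ ?_
    by_contra hcon
    have hb : q (kuhnVertex v τ k) ∈ Metric.ball (q (kuhnVertex v τ 0)) δ := by
      rw [Metric.mem_ball]
      refine lt_of_le_of_lt ((dist_pi_le_iff (by positivity)).2 fun i => ?_) hm
      refine (LipschitzWith.dist_le_mul (LipschitzWith.projIcc (zero_le_one (α := ℝ))) _ _).trans ?_
      rw [NNReal.coe_one, one_mul, Real.dist_eq, ← sub_div, abs_div, abs_of_pos hm0]
      gcongr
      simp only [kuhnVertex]
      split_ifs <;> simp
    exact Set.mem_iInter.1 (ht hb) ⟨_, hcon⟩ (hcol _)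
  have hsub : (Finset.range (n + 1) : Set ℕ) ⊆ lab '' {c | t ∈ W c} := by
    rw [← hfull]
    intro y hy
    obtain ⟨k, -, rfl⟩ := Finset.mem_image.1 (Finset.mem_coe.1 hy)
    exact ⟨_, hmem k, rfl⟩
  calc n + 1 = (Finset.range (n + 1) : Set ℕ).ncard := by simp
    _ ≤ (lab '' {c | t ∈ W c}).ncard := Set.ncard_le_ncard hsub (Set.toFinite _)
    _ ≤ _ := Set.ncard_image_le (Set.toFinite _)

theorem exists_mem_many_of_open_cover_cube {κ ι : Type*} [Finite κ] [Fintype ι]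
    (W : κ → Set (ι → unitInterval)) (hW : ∀ c, IsOpen (W c)) (hcov : ⋃ c, W c = Set.univ)
    (hsep : ∀ c i, (∀ t ∈ W c, t i ≠ 0) ∨ (∀ t ∈ W c, t i ≠ 1)) :
    ∃ t, Fintype.card ι + 1 ≤ {c | t ∈ W c}.ncard := by
  let e := Fintype.equivFin ι
  let f : (Fin (Fintype.card ι) → unitInterval) → (ι → unitInterval) := fun t i => t (e i)
  have hf : Continuous f := by fun_prop
  obtain ⟨t, ht⟩ := exists_mem_many_of_open_cover_cube_fin (fun c => f ⁻¹' W c)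
    (fun c => (hW c).preimage hf) (by rw [← Set.preimage_iUnion, hcov, Set.preimage_univ])
    (fun c i => (hsep c (e.symm i)).imp (fun h t ht => by simpa [f] using h _ ht)
      (fun h t ht => by simpa [f] using h _ ht))
  exact ⟨f t, ht⟩

lemma bddAbove_ordOn {Y : Type*} (X : Set Y) (β : Finset (Set Y)) :
    BddAbove (Set.range fun y : X => {U : Set Y | U ∈ β ∧ (y : Y) ∈ U}.ncard - 1) := by
  refine ⟨β.card, ?_⟩
  rintro _ ⟨y, rfl⟩
  refine (Nat.sub_le _ _).trans ?_
  rw [← Set.ncard_coe_finset]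
  exact Set.ncard_le_ncard (fun U hU => hU.1) (Finset.finite_toSet β)

lemma card_le_ordOn {Y ι : Type*} [TopologicalSpace Y] [Fintype ι] {X : Set Y}
    {β : Finset (Set Y)} (hβ : IsOpenCoverOf X β) {φ : (ι → unitInterval) → Y}
    (hφ : Continuous φ) (hφX : ∀ t, φ t ∈ X)
    (hsep : ∀ U ∈ β, ∀ i, (∀ t, φ t ∈ U → t i ≠ 0) ∨ (∀ t, φ t ∈ U → t i ≠ 1)) :
    Fintype.card ι ≤ ordOn X β := by
  obtain ⟨t, ht⟩ := exists_mem_many_of_open_cover_cube (κ := β) (fun U => φ ⁻¹' U)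
    (fun U => (hβ.1 U U.2).preimage hφ)
    (Set.eq_univ_of_forall fun t => by simpa using hβ.2 (hφX t))
    (fun U i => hsep U U.2 i)
  refine le_trans ?_ (le_ciSup (bddAbove_ordOn X β) ⟨φ t, hφX t⟩)
  have : {U : Set Y | U ∈ β ∧ φ t ∈ U} = Subtype.val '' {U : β | t ∈ φ ⁻¹' (U : Set Y)} := by
    ext U; simp [and_comm]
  rw [this, Set.ncard_image_of_injective _ Subtype.val_injective]
  omega

lemma card_le_Dcov {Y ι : Type*} [TopologicalSpace Y] [Fintype ι] {X : Set Y}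
    {α : Finset (Set Y)} (hα : IsOpenCoverOf X α) {φ : (ι → unitInterval) → Y}
    (hφ : Continuous φ) (hφX : ∀ t, φ t ∈ X)
    (hsep : ∀ U ∈ α, ∀ i, (∀ t, φ t ∈ U → t i ≠ 0) ∨ (∀ t, φ t ∈ U → t i ≠ 1)) :
    Fintype.card ι ≤ Dcov X α := by
  refine le_csInf ⟨_, α, hα, fun U hU => ⟨U, hU, subset_rfl⟩, rfl⟩ ?_
  rintro _ ⟨β, hβ, href, rfl⟩
  refine card_le_ordOn hβ hφ hφX fun U hU i => ?_
  obtain ⟨V, hV, hUV⟩ := href U hU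
  exact (hsep V hV i).imp (fun h t ht => h t (hUV ht)) (fun h t ht => h t (hUV ht))

lemma exists_forall_abs_lt_imp_dist_lt (N : ℕ) {ε : ℝ} (hε : 0 < ε) :
    ∃ δ > 0, ∀ x y : EuclideanSpace ℝ (Fin N), (∀ i, |x i - y i| < δ) → dist x y < ε := by
  obtain ⟨δ, hδ, h⟩ := Metric.uniformContinuous_iff.1
    (PiLp.uniformContinuous_toLp 2 (fun _ : Fin N => ℝ)) ε hε
  refine ⟨δ, hδ, fun x y hxy => ?_⟩
  have : dist (WithLp.ofLp x) (WithLp.ofLp y) < δ :=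
    (dist_pi_lt_iff hδ).2 fun i => by rw [Real.dist_eq]; exact hxy i
  exact h this

/-- The hyperplane on which the `i`-th coordinate equals `t`. -/
def coordHyperplane {N : ℕ} (i : Fin N) (t : ℝ) : AffineSubspace ℝ (EuclideanSpace ℝ (Fin N)) where
  carrier := {x | x i = t}
  smul_vsub_vadd_mem' := by
    intro c p₁ p₂ p₃ h₁ h₂ h₃
    simp only [Set.mem_ofPred_eq] at h₁ h₂ h₃
    simp [h₁, h₂, h₃]

lemma mem_coordHyperplane {N : ℕ} {i : Fin N} {t : ℝ} {x : EuclideanSpace ℝ (Fin N)} :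
    x ∈ coordHyperplane i t ↔ x i = t := Iff.rfl

lemma finrank_direction_inf_lt {N : ℕ} {A H : AffineSubspace ℝ (EuclideanSpace ℝ (Fin N))}
    (hne : ((A ⊓ H : AffineSubspace ℝ _) : Set (EuclideanSpace ℝ (Fin N))).Nonempty)
    (hAH : ¬ A ≤ H) :
    Module.finrank ℝ (A ⊓ H).direction < Module.finrank ℝ A.direction :=
  Submodule.finrank_lt_finrank_of_lt
    (AffineSubspace.direction_lt_of_nonempty (inf_lt_left.2 hAH) hne)

/-- A bounded set lying in finitely many flats of dimension less than `c` has arbitrarily fine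
finite open covers of multiplicity at most `c`. -/
theorem exists_fine_open_cover {N : ℕ} (c : ℕ) {κ : Type} [Finite κ]
    (A : κ → AffineSubspace ℝ (EuclideanSpace ℝ (Fin N)))
    (hA : ∀ j, (A j : Set (EuclideanSpace ℝ (Fin N))).Nonempty →
      Module.finrank ℝ (A j).direction < c)
    (K : Set (EuclideanSpace ℝ (Fin N))) (hKb : Bornology.IsBounded K)
    (hK : K ⊆ ⋃ j, (A j : Set (EuclideanSpace ℝ (Fin N)))) {ε : ℝ} (hε : 0 < ε) :
    ∃ β : Finset (Set (EuclideanSpace ℝ (Fin N))), IsOpenCoverOf K β ∧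
      (∀ U ∈ β, ∀ x ∈ U, ∀ y ∈ U, dist x y < ε) ∧ ∀ y, {U | U ∈ β ∧ y ∈ U}.ncard ≤ c := by
  classical
  induction c generalizing κ K with
  | zero =>
    have hempty : K = ∅ := by
      refine Set.eq_empty_of_forall_notMem fun x hx => ?_
      obtain ⟨j, hj⟩ := Set.mem_iUnion.1 (hK hx)
      exact absurd (hA j ⟨x, hj⟩) (Nat.not_lt_zero _)
    exact ⟨∅, by simp [IsOpenCoverOf, hempty], by simp, by simp⟩
  | succ c ih =>
    obtain ⟨δ, hδ, hδε⟩ := exists_forall_abs_lt_imp_dist_lt N hε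
    obtain ⟨R, hR⟩ := hKb.exists_norm_le
    obtain ⟨M, hM⟩ := exists_nat_ge (R / δ + 2)
    let Z := Finset.Icc (-(M : ℤ)) M
    have hfin : (⋃ p : κ × Fin N × Z, {θ : ℝ | (A p.1 : Set (EuclideanSpace ℝ (Fin N))).Nonempty ∧
        A p.1 ≤ coordHyperplane p.2.1 (θ + (p.2.2 : ℤ) * δ)}).Finite := by
      refine Set.finite_iUnion fun p => Set.Subsingleton.finite ?_
      rintro θ ⟨⟨x, hx⟩, h₁⟩ θ' ⟨-, h₂⟩
      have e₁ := mem_coordHyperplane.1 (h₁ hx)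
      have e₂ := mem_coordHyperplane.1 (h₂ hx)
      linarith
    obtain ⟨θ, ⟨hθ0, hθδ⟩, hθ⟩ := ((Set.Ioo_infinite hδ).sdiff hfin).nonempty
    let L : Set (EuclideanSpace ℝ (Fin N)) := K ∩ ⋃ p : Fin N × Z, {x | x p.1 = θ + (p.2 : ℤ) * δ}
    let A' : κ × Fin N × Z → AffineSubspace ℝ (EuclideanSpace ℝ (Fin N)) :=
      fun p => A p.1 ⊓ coordHyperplane p.2.1 (θ + (p.2.2 : ℤ) * δ)
    obtain ⟨β, hβcov, hβε, hβc⟩ := ih A' (by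
      intro p hp
      have hne : (A p.1 : Set (EuclideanSpace ℝ (Fin N))).Nonempty := hp.mono fun x hx => hx.1
      refine lt_of_lt_of_le (finrank_direction_inf_lt hp fun hle => hθ ?_)
        (Nat.lt_succ_iff.1 (hA p.1 hne))
      exact Set.mem_iUnion.2 ⟨p, hne, hle⟩)
      L (hKb.subset Set.inter_subset_left) (by
        rintro x ⟨hxK, hx⟩
        obtain ⟨j, hj⟩ := Set.mem_iUnion.1 (hK hxK)
        obtain ⟨p, hp⟩ := Set.mem_iUnion.1 hx
        exact Set.mem_iUnion.2 ⟨(j, p), hj, hp⟩)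
    let B : (Fin N → ℤ) → Set (EuclideanSpace ℝ (Fin N)) :=
      fun k => {x | ∀ i, θ + k i * δ < x i ∧ x i < θ + (k i + 1) * δ}
    have hBopen : ∀ k, IsOpen (B k) := by
      intro k
      simp only [B, Set.ofPred_forall]
      refine isOpen_iInter_of_finite fun i => ?_
      have h1 : IsOpen {x : EuclideanSpace ℝ (Fin N) | θ + k i * δ < x i} :=
        isOpen_lt (by fun_prop) (by fun_prop)
      have h2 : IsOpen {x : EuclideanSpace ℝ (Fin N) | x i < θ + (k i + 1) * δ} :=
        isOpen_lt (by fun_prop) (by fun_prop)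
      exact h1.inter h2
    have hBle : ∀ k k' x, x ∈ B k → x ∈ B k' → k ≤ k' := by
      intro k k' x hx hx' i
      have h := (hx i).1.trans (hx' i).2
      have h' : (k i : ℝ) < k' i + 1 := by
        by_contra! hcon
        nlinarith
      exact Int.lt_add_one_iff.1 (by exact_mod_cast h')
    let β' := (Fintype.piFinset fun _ : Fin N => Z).image B
    refine ⟨β ∪ β', ⟨?_, ?_⟩, ?_, ?_⟩
    · intro U hU
      rcases Finset.mem_union.1 hU with hU | hU
      · exact hβcov.1 U hU
      · obtain ⟨k, -, rfl⟩ := Finset.mem_image.1 hU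
        exact hBopen k
    · intro x hx
      by_cases hxL : x ∈ L
      · obtain ⟨U, hU, hxU⟩ := Set.mem_iUnion₂.1 (hβcov.2 hxL)
        exact Set.mem_iUnion₂.2 ⟨U, Finset.mem_union_left _ hU, hxU⟩
      · let k : Fin N → ℤ := fun i => ⌊(x i - θ) / δ⌋
        have hkZ : ∀ i, k i ∈ Z := by
          intro i
          have hxi : |x i| ≤ R := (PiLp.norm_apply_le x i).trans (hR x hx)
          obtain ⟨h1, h2⟩ := abs_le.1 hxi
          have hRδ : R / δ * δ = R := div_mul_cancel₀ _ hδ.ne'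
          rw [Finset.mem_Icc]
          constructor
          · rw [Int.le_floor, le_div_iff₀ hδ]
            push_cast
            nlinarith
          · have : (k i : ℝ) ≤ M := by
              refine (Int.floor_le _).trans ?_
              rw [div_le_iff₀ hδ]
              nlinarith
            exact_mod_cast this
        refine Set.mem_iUnion₂.2 ⟨B k, Finset.mem_union_right _
          (Finset.mem_image_of_mem _ (Fintype.mem_piFinset.2 hkZ)), fun i => ⟨?_, ?_⟩⟩
        · have h1 : (k i : ℝ) ≤ (x i - θ) / δ := Int.floor_le _
          rw [le_div_iff₀ hδ] at h1
          refine lt_of_le_of_ne (by linarith) fun heq => hxL ⟨hx, ?_⟩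
          exact Set.mem_iUnion.2 ⟨(i, ⟨k i, hkZ i⟩), heq.symm⟩
        · have h1 : (x i - θ) / δ < k i + 1 := Int.lt_floor_add_one _
          rw [div_lt_iff₀ hδ] at h1
          linarith
    · intro U hU x hx y hy
      rcases Finset.mem_union.1 hU with hU | hU
      · exact hβε U hU x hx y hy
      · obtain ⟨k, -, rfl⟩ := Finset.mem_image.1 hU
        refine hδε x y fun i => ?_
        have h1 := hx i
        have h2 := hy i
        rw [abs_lt]
        constructor <;> nlinarith
    · intro y
      have hsub : {U | U ∈ β ∪ β' ∧ y ∈ U} ⊆ {U | U ∈ β ∧ y ∈ U} ∪ {U | U ∈ β' ∧ y ∈ U} := by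
        rintro U ⟨hU, hy⟩
        exact (Finset.mem_union.1 hU).imp (fun h => ⟨h, hy⟩) (fun h => ⟨h, hy⟩)
      have hone : {U | U ∈ β' ∧ y ∈ U}.ncard ≤ 1 := by
        have : Finite {U | U ∈ β' ∧ y ∈ U} := (β'.finite_toSet).subset fun U hU => hU.1
        refine Set.ncard_le_one_iff_subsingleton.2 ?_
        rintro U ⟨hU, hyU⟩ V ⟨hV, hyV⟩
        obtain ⟨k, -, rfl⟩ := Finset.mem_image.1 hU
        obtain ⟨k', -, rfl⟩ := Finset.mem_image.1 hV
        rw [le_antisymm (hBle k k' y hyU hyV) (hBle k' k y hyV hyU)]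
      have hf : ∀ γ : Finset (Set (EuclideanSpace ℝ (Fin N))), {U | U ∈ γ ∧ y ∈ U}.Finite :=
        fun γ => γ.finite_toSet.subset fun U hU => hU.1
      calc _ ≤ _ := Set.ncard_le_ncard hsub ((hf _).union (hf _))
        _ ≤ _ := Set.ncard_union_le _ _
        _ ≤ c + 1 := add_le_add (hβc y) hone

/-- The topological dimension of a finite union of simplices is at most the largest dimension of
the simplices. -/
theorem topDim_biUnion_convexHull_le {N : ℕ} (S : Finset (Finset (EuclideanSpace ℝ (Fin N))))
    (d : ℕ) (hd : ∀ s ∈ S,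
      Module.finrank ℝ (vectorSpan ℝ (s : Set (EuclideanSpace ℝ (Fin N)))) ≤ d) :
    topDim (⋃ s ∈ S, convexHull ℝ (s : Set (EuclideanSpace ℝ (Fin N)))) ≤ d := by
  classical
  set P := ⋃ s ∈ S, convexHull ℝ (s : Set (EuclideanSpace ℝ (Fin N))) with hP
  have hPc : IsCompact P := S.isCompact_biUnion fun s _ => s.finite_toSet.isCompact_convexHull ℝ
  refine iSup₂_le fun α hα => ?_
  rw [Set.mem_ofPred_eq] at hα
  obtain ⟨ε, hε, hball⟩ := lebesgue_number_lemma_of_metric_sUnion (c := (α : Set (Set _))) hPc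
    (fun V hV => hα.1 V hV) (by simpa [Set.sUnion_eq_biUnion] using hα.2)
  obtain ⟨β, hβ, hβε, hβc⟩ := exists_fine_open_cover (d + 1)
    (fun s : S => affineSpan ℝ ((s : Finset (EuclideanSpace ℝ (Fin N))) : Set _))
    (fun s _ => by rw [direction_affineSpan]; exact Nat.lt_succ_of_le (hd s s.2))
    P hPc.isBounded (fun x hx => by
      obtain ⟨s, hs, hxs⟩ := Set.mem_iUnion₂.1 hx
      exact Set.mem_iUnion.2 ⟨⟨s, hs⟩, convexHull_subset_affineSpan _ hxs⟩) hε
  let γ := β.filter fun U => (U ∩ P).Nonempty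
  have hγ : IsOpenCoverOf P γ := by
    refine ⟨fun U hU => hβ.1 U (Finset.mem_filter.1 hU).1, fun x hx => ?_⟩
    obtain ⟨U, hU, hxU⟩ := Set.mem_iUnion₂.1 (hβ.2 hx)
    exact Set.mem_iUnion₂.2 ⟨U, Finset.mem_filter.2 ⟨hU, x, hxU, hx⟩, hxU⟩
  have hγα : ∀ U ∈ γ, ∃ V ∈ α, U ⊆ V := by
    intro U hU
    obtain ⟨hUβ, x, hxU, hxP⟩ := Finset.mem_filter.1 hU
    obtain ⟨V, hV, hxV⟩ := hball x hxP
    exact ⟨V, hV, fun y hy => hxV (hβε U hUβ y hy x hxU)⟩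
  have hord : ordOn P γ ≤ d := by
    refine ciSup_le' fun y => ?_
    have : {U | U ∈ γ ∧ (y : EuclideanSpace ℝ (Fin N)) ∈ U}.ncard ≤ d + 1 :=
      (Set.ncard_le_ncard (t := {U | U ∈ β ∧ (y : EuclideanSpace ℝ (Fin N)) ∈ U})
        (fun U hU => ⟨(Finset.mem_filter.1 hU.1).1, hU.2⟩)
        (β.finite_toSet.subset fun U hU => hU.1)).trans (hβc y)
    omega
  exact_mod_cast (Nat.sInf_le ⟨γ, hγ, hγα, rfl⟩ : Dcov P α ≤ ordOn P γ).trans hord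

/-- A nonempty polyhedron contains a cube of the dimension of the polyhedron. -/
theorem IsPolyhedron.exists_cube {N : ℕ} {P : Set (EuclideanSpace ℝ (Fin N))}
    (hP : IsPolyhedron P) (hne : P.Nonempty) :
    ∃ (b : Type) (_ : Fintype b) (e : (b → unitInterval) → P),
      Continuous e ∧ Function.Injective e ∧ topDim P ≤ Fintype.card b := by
  obtain ⟨S, rfl⟩ := hP
  let f : Finset (EuclideanSpace ℝ (Fin N)) → ℕ :=
    fun s => Module.finrank ℝ (vectorSpan ℝ (s : Set (EuclideanSpace ℝ (Fin N))))
  let S' := S.filter fun s => s.Nonempty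
  have hS' : S'.Nonempty := by
    obtain ⟨x, hx⟩ := hne
    obtain ⟨s, hs, hxs⟩ := Set.mem_iUnion₂.1 hx
    exact ⟨s, Finset.mem_filter.2 ⟨hs, by simpa using convexHull_nonempty_iff.1 ⟨x, hxs⟩⟩⟩
  obtain ⟨s, hsS', hmax⟩ := S'.exists_max_image f hS'
  obtain ⟨hsS, p, hp⟩ := Finset.mem_filter.1 hsS'
  obtain ⟨b, hbs, hbspan, hbli⟩ := exists_linearIndependent ℝ
    ((· -ᵥ p) '' (s : Set (EuclideanSpace ℝ (Fin N))))
  have : Fintype b := (((s.finite_toSet).image _).subset hbs).fintype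
  have hcard : Fintype.card b = f s := by
    simp only [f]
    rw [vectorSpan_eq_span_vsub_set_right ℝ (Finset.mem_coe.2 hp), ← hbspan,
      finrank_span_set_eq_card hbli, Set.toFinset_card]
  let e : (b → unitInterval) → EuclideanSpace ℝ (Fin N) := fun t =>
    p + (Fintype.card b : ℝ)⁻¹ • ∑ w, (t w : ℝ) • (w : EuclideanSpace ℝ (Fin N))
  have heC : Continuous e := by fun_prop
  have heP : ∀ t, e t ∈ convexHull ℝ (s : Set (EuclideanSpace ℝ (Fin N))) := by
    intro t
    have hpc : p ∈ convexHull ℝ (s : Set (EuclideanSpace ℝ (Fin N))) :=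
      subset_convexHull _ _ (Finset.mem_coe.2 hp)
    rcases isEmpty_or_nonempty b with hb | hb
    · simpa [e] using hpc
    · have hc0 : (Fintype.card b : ℝ) ≠ 0 := Nat.cast_ne_zero.2 Fintype.card_ne_zero
      have : e t = ∑ w : b, (Fintype.card b : ℝ)⁻¹ • (p + (t w : ℝ) • (w : EuclideanSpace ℝ _)) := by
        rw [← Finset.smul_sum, Finset.sum_add_distrib, smul_add, Finset.sum_const,
          Finset.card_univ, ← Nat.cast_smul_eq_nsmul ℝ, smul_smul, inv_mul_cancel₀ hc0, one_smul]
      rw [this]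
      refine (convex_convexHull ℝ _).sum_mem (fun _ _ => by positivity) ?_ fun w _ => ?_
      · rw [Finset.sum_const, Finset.card_univ, nsmul_eq_mul, mul_inv_cancel₀ hc0]
      · obtain ⟨x, hx, hxw⟩ := hbs w.2
        refine (convex_convexHull ℝ _).segment_subset hpc (subset_convexHull _ _ hx) ?_
        rw [segment_eq_image']
        exact ⟨t w, (t w).2, by rw [← hxw]; rfl⟩
  have heinj : Function.Injective e := by
    intro t t' h
    rcases isEmpty_or_nonempty b with hb | hb
    · exact Subsingleton.elim _ _
    · have hc0 : (Fintype.card b : ℝ)⁻¹ ≠ 0 :=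
        inv_ne_zero (Nat.cast_ne_zero.2 Fintype.card_ne_zero)
      have h1 := smul_right_injective _ hc0 (add_left_cancel h)
      have h2 : ∑ w : b, ((t w : ℝ) - t' w) • (w : EuclideanSpace ℝ (Fin N)) = 0 := by
        simp only [sub_smul, Finset.sum_sub_distrib]
        exact sub_eq_zero.2 h1
      funext w
      exact Subtype.ext (sub_eq_zero.1 (Fintype.linearIndependent_iff.1 hbli _ h2 w))
  refine ⟨b, this, fun t => ⟨e t, Set.mem_biUnion hsS (heP t)⟩, heC.subtype_mk _,
    fun t t' h => heinj (congrArg Subtype.val h), ?_⟩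
  rw [hcard]
  refine topDim_biUnion_convexHull_le S (f s) fun u hu => ?_
  rcases u.eq_empty_or_nonempty with rfl | hne
  · rw [Finset.coe_empty, vectorSpan_empty, finrank_bot]
    exact Nat.zero_le _
  · exact hmax u (Finset.mem_filter.2 ⟨hu, hne⟩)

open Classical in
/-- Every finite set has a translate that meets `J` in at least the proportion given by the upper
Banach density of `J`. -/
theorem exists_translate_upperDensity_le {G : Type*} [Group G] (hG : IsAmenable G) (J : Set G)
    {F : Finset G} (hF : F.Nonempty) :
    ∃ g : G, upperDensity G J * F.card ≤ (F.filter fun f => f * g ∈ J).card := by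
  by_contra! hcon
  let count : G → ℕ := fun g => (F.filter fun f => f * g ∈ J).card
  have hbdd : BddAbove (Set.range count) :=
    ⟨F.card, by rintro _ ⟨g, rfl⟩; exact Finset.card_filter_le _ _⟩
  obtain ⟨g₀, hg₀⟩ := Nat.sSup_mem ⟨count 1, Set.mem_range_self 1⟩ hbdd
  have hmax : ∀ g, count g ≤ count g₀ := fun g => hg₀ ▸ le_csSup hbdd (Set.mem_range_self g)
  have hFpos : (0 : ℝ) < F.card := by exact_mod_cast hF.card_pos
  set r : ℝ := count g₀ / F.card with hr
  have hrlt : r < upperDensity G J := (div_lt_iff₀ hFpos).2 (hcon g₀)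
  obtain ⟨Fo₀, hFo₀⟩ := hG
  obtain ⟨_, ⟨Fo, hFo, rfl⟩, hlt⟩ := exists_lt_of_lt_csSup (by exact ⟨_, Fo₀, hFo₀, rfl⟩) hrlt
  obtain ⟨r', hrr', hr'⟩ := exists_between hlt
  have hfreq := Filter.frequently_lt_of_lt_limsup
    (Filter.isCoboundedUnder_le_of_le Filter.atTop (x := 0) fun n => by positivity) hr'
  have hev : ∀ᶠ n in Filter.atTop, ∀ f ∈ F,
      ((symmDiff (f • ((Fo n) : Set G)) ((Fo n) : Set G)).ncard : ℝ) / (Fo n).card < r' - r :=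
    (Filter.eventually_all_finset F).2 fun f _ =>
      (hFo.2 f).eventually_lt_const (sub_pos.2 hrr')
  obtain ⟨n, hn, hnF⟩ := (hfreq.and_eventually hev).exists
  set K := Fo n
  have hKpos : (0 : ℝ) < K.card := by exact_mod_cast (hFo.1 n).card_pos
  have hdouble : ∑ g ∈ K, count g = ∑ f ∈ F, (K.filter fun g => f * g ∈ J).card := by
    simp only [count, Finset.card_filter]
    exact Finset.sum_comm
  have hupper : (∑ g ∈ K, count g : ℝ) ≤ r * F.card * K.card := by
    calc (∑ g ∈ K, count g : ℝ) ≤ ∑ _g ∈ K, (count g₀ : ℝ) :=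
          Finset.sum_le_sum fun g _ => by exact_mod_cast hmax g
      _ = r * F.card * K.card := by
          rw [Finset.sum_const, nsmul_eq_mul, hr, div_mul_cancel₀ _ hFpos.ne', mul_comm]
  have hlower : ∀ f ∈ F, r * K.card < (K.filter fun g => f * g ∈ J).card := by
    intro f hf
    have hsub : J ∩ (K : Set G) ⊆ (fun g => f * g) '' (K.filter fun g => f * g ∈ J : Finset G) ∪
        symmDiff (f • (K : Set G)) (K : Set G) := by
      rintro x ⟨hxJ, hxK⟩
      by_cases hx : x ∈ f • (K : Set G)
      · obtain ⟨g, hg, rfl⟩ := hx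
        exact Or.inl ⟨g, by simpa using ⟨hg, hxJ⟩, rfl⟩
      · exact Or.inr (Or.inr ⟨hxK, hx⟩)
    have hfin : (symmDiff (f • (K : Set G)) (K : Set G)).Finite :=
      ((K.finite_toSet.image _).symmDiff K.finite_toSet)
    have h1 : (J ∩ (K : Set G)).ncard ≤ (K.filter fun g => f * g ∈ J).card +
        (symmDiff (f • (K : Set G)) (K : Set G)).ncard := by
      refine (Set.ncard_le_ncard hsub (((Finset.finite_toSet _).image _).union hfin)).trans ?_
      refine (Set.ncard_union_le _ _).trans (Nat.add_le_add_right ?_ _)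
      exact (Set.ncard_image_le (Finset.finite_toSet _)).trans (Set.ncard_coe_finset _).le
    have h1' : ((J ∩ (K : Set G)).ncard : ℝ) ≤ (K.filter fun g => f * g ∈ J).card +
        (symmDiff (f • (K : Set G)) (K : Set G)).ncard := by exact_mod_cast h1
    have h2 := (div_lt_iff₀ hKpos).1 (hnF f hf)
    have h3 := (lt_div_iff₀ hKpos).1 hn
    linarith
  have hlower' : r * F.card * K.card < (∑ g ∈ K, count g : ℝ) := by
    have : (∑ g ∈ K, (count g : ℝ)) = ∑ f ∈ F, ((K.filter fun g => f * g ∈ J).card : ℝ) := by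
      exact_mod_cast hdouble
    rw [this]
    calc r * F.card * K.card = ∑ _f ∈ F, r * K.card := by
          rw [Finset.sum_const, nsmul_eq_mul]; ring
      _ < _ := Finset.sum_lt_sum_of_nonempty hF hlower
  exact absurd hupper (not_le.2 hlower')

lemma mem_FCover {H Y : Type*} {σ : H → Y → Y} {F : Finset H} {α : Finset (Set Y)} {U : Set Y} :
    U ∈ FCover σ F α ↔ ∃ f : F → Set Y, (∀ g, f g ∈ α) ∧ U = ⋂ g : F, σ g ⁻¹' f g := by
  simp only [FCover, Finset.mem_image, Finset.mem_pi]
  constructor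
  · rintro ⟨f, hf, rfl⟩
    exact ⟨fun g => f g g.2, fun g => hf g g.2, by ext; simp⟩
  · rintro ⟨f, hf, rfl⟩
    exact ⟨fun g hg => f ⟨g, hg⟩, fun g hg => hf ⟨g, hg⟩, by ext; simp⟩

lemma isOpenCoverOf_FCover {H Y : Type*} [TopologicalSpace Y] {σ : H → Y → Y}
    (hσ : ∀ g, Continuous (σ g)) (F : Finset H) {X : Set Y} (hX : ∀ g, Set.MapsTo (σ g) X X)
    {α : Finset (Set Y)} (hα : IsOpenCoverOf X α) : IsOpenCoverOf X (FCover σ F α) := by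
  constructor
  · intro U hU
    obtain ⟨f, hf, rfl⟩ := mem_FCover.1 hU
    exact isOpen_iInter_of_finite fun g => (hα.1 _ (hf g)).preimage (hσ g)
  · intro x hx
    have : ∀ g : F, ∃ V ∈ α, σ g x ∈ V := fun g => by
      simpa using hα.2 (hX g hx)
    choose f hf hxf using this
    exact Set.mem_iUnion₂.2 ⟨_, mem_FCover.2 ⟨f, hf, rfl⟩, Set.mem_iInter.2 hxf⟩

lemma continuous_shiftAct {G A : Type*} [Group G] [TopologicalSpace A] (c : G) :
    Continuous (shiftAct c : (G → A) → G → A) :=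
  continuous_pi fun g => continuous_apply (g * c)

/-- The finite open cover of `P` by the sets that avoid one of any two opposite faces of an
embedded cube, pulled back along the coordinate `1`. -/
noncomputable def faceCover (G : Type*) [Group G] {P b : Type*} [Fintype b]
    (e : (b → unitInterval) → P) : Finset (Set (G → P)) :=
  letI := Classical.decEq (Set (G → P))
  letI := Classical.decEq b
  (Finset.univ : Finset (b → Bool)).image fun ε =>
    ⋂ i, {x | x 1 ∉ e '' {t | t i = if ε i then 1 else 0}}

lemma mem_faceCover {G P b : Type*} [Group G] [Fintype b] {e : (b → unitInterval) → P}
    {U : Set (G → P)} : U ∈ faceCover G e ↔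
      ∃ ε : b → Bool, U = ⋂ i, {x | x 1 ∉ e '' {t | t i = if ε i then 1 else 0}} := by
  simp only [faceCover, Finset.mem_image, Finset.mem_univ, true_and]
  constructor <;> rintro ⟨ε, h⟩ <;> exact ⟨ε, h.symm⟩

lemma isOpenCoverOf_faceCover {G P b : Type*} [Group G] [TopologicalSpace P] [T2Space P]
    [Fintype b] {e : (b → unitInterval) → P} (he : Continuous e) (hinj : Function.Injective e)
    (X : Set (G → P)) : IsOpenCoverOf X (faceCover G e) := by
  classical
  constructor
  · intro U hU
    obtain ⟨ε, rfl⟩ := mem_faceCover.1 hU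
    refine isOpen_iInter_of_finite fun i => ?_
    have hcl : IsClosed (e '' {t | t i = if ε i then 1 else 0}) :=
      ((isClosed_eq (continuous_apply i) continuous_const).isCompact.image he).isClosed
    have h1 : Continuous fun x : G → P => x 1 := continuous_apply 1
    exact hcl.isOpen_compl.preimage h1
  · intro x _
    refine Set.mem_iUnion₂.2 ⟨_, mem_faceCover.2
      ⟨fun i => decide (x 1 ∈ e '' {t | t i = 0}), rfl⟩, Set.mem_iInter.2 fun i => ?_⟩
    show x 1 ∉ e '' {t | t i = if decide (x 1 ∈ e '' {t | t i = 0}) = true then 1 else 0}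
    by_cases hx : x 1 ∈ e '' {t | t i = 0}
    · rw [decide_eq_true hx, if_pos rfl]
      rintro ⟨t, ht, hxt⟩
      obtain ⟨s, hs, hxs⟩ := hx
      have hts : t = s := hinj (hxt.trans hxs.symm)
      exact zero_ne_one ((show s i = 0 from hs).symm.trans (hts ▸ show t i = 1 from ht))
    · rw [decide_eq_false hx, if_neg Bool.false_ne_true]
      exact hx

open Classical in
/-- If the coordinates in `J` are free in `X`, then `X` contains cubes of dimension proportional
to the number of elements of a translate of `F` in `J`. -/
theorem card_mul_card_le_Dcov {G P b : Type*} [Group G] [TopologicalSpace P] [T2Space P]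
    [Fintype b] {e : (b → unitInterval) → P} (he : Continuous e) (hinj : Function.Injective e)
    {X : Set (G → P)} (hXinv : ∀ c : G, shiftAct c '' X = X) {x' : G → P} {J : Set G}
    (hJ : ∀ x : G → P, (∀ g ∉ J, x g = x' g) → x ∈ X) (F : Finset G) (g : G) :
    (F.filter fun f => f * g ∈ J).card * Fintype.card b ≤
      Dcov X (FCover (fun c (x : G → P) => shiftAct c x) F (faceCover G e)) := by
  set F' := F.filter fun f => f * g ∈ J with hF'
  let y : (F' × b → unitInterval) → G → P := fun t h =>
    if hh : h * g⁻¹ ∈ F' then e (fun i => t (⟨h * g⁻¹, hh⟩, i)) else x' h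
  have hyX : ∀ t, y t ∈ X := fun t => hJ _ fun h hh => dif_neg fun hmem => hh (by
    simpa using (Finset.mem_filter.1 hmem).2)
  have hyC : Continuous y := by
    refine continuous_pi fun h => ?_
    by_cases hh : h * g⁻¹ ∈ F'
    · simp only [y, dif_pos hh]
      fun_prop
    · simp only [y, dif_neg hh]
      fun_prop
  have hval : ∀ (t) (f : F'), shiftAct (f : G) (shiftAct g (y t)) 1 = e fun i => t (f, i) := by
    intro t f
    have hf : (f : G) * g * g⁻¹ = f := by group
    have hf' : (f : G) * g * g⁻¹ ∈ F' := by rw [hf]; exact f.2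
    have hs : (⟨(f : G) * g * g⁻¹, hf'⟩ : F') = f := Subtype.ext hf
    simp only [shiftAct, one_mul, y, dif_pos hf', hs]
  have hcard : Fintype.card (F' × b) = F'.card * Fintype.card b := by simp
  rw [← hcard]
  refine card_le_Dcov (φ := fun t => shiftAct g (y t))
    (isOpenCoverOf_FCover continuous_shiftAct F
      (fun c x hx => hXinv c ▸ Set.mem_image_of_mem _ hx) (isOpenCoverOf_faceCover he hinj X))
    ((continuous_shiftAct g).comp hyC)
    (fun t => hXinv g ▸ Set.mem_image_of_mem _ (hyX t)) ?_
  rintro U hU ⟨f, w⟩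
  obtain ⟨V, hV, rfl⟩ := mem_FCover.1 hU
  let f₀ : F := ⟨f, (Finset.mem_filter.1 f.2).1⟩
  obtain ⟨ε, hε⟩ := mem_faceCover.1 (hV f₀)
  have key : ∀ t, shiftAct g (y t) ∈ ⋂ c : F, (fun x => shiftAct (c : G) x) ⁻¹' V c →
      t (f, w) ≠ if ε w then 1 else 0 := by
    intro t ht htw
    have h1 := Set.mem_iInter.1 ht f₀
    rw [Set.mem_preimage, hε] at h1
    exact Set.mem_iInter.1 h1 w ⟨_, htw, (hval t f).symm⟩
  cases hw : ε w
  · exact Or.inl fun t ht => by simpa [hw] using key t ht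
  · exact Or.inr fun t ht => by simpa [hw] using key t ht

/-- Lower bound on the mean topological dimension of a subshift of
`P^G` in terms of the density of a set of free coordinates. -/
theorem mdim_lower_bound
    {G : Type*} [Group G] [Countable G] [Infinite G] (hG : IsAmenable G)
    {N : ℕ} (P : Set (EuclideanSpace ℝ (Fin N))) (hP : IsPolyhedron P)
    (X : Set (G → ↥P)) (hXc : IsClosed X) (hXinv : ∀ c : G, shiftAct c '' X = X)
    (x' : G → ↥P) (hx' : x' ∈ X) (J : Set G)
    (h : ∀ x : G → ↥P, (∀ g ∉ J, x g = x' g) → x ∈ X) :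
    ∀ Fo : ℕ → Finset G, IsFolnerSeq G Fo →
      ENNReal.ofReal (upperDensity G J) * ENat.toENNReal (topDim P) ≤
        mdim (fun c (x : G → ↥P) => shiftAct c x) X Fo := by
  classical
  intro Fo hFo
  obtain ⟨b, _, e, he, hinj, hdim⟩ := hP.exists_cube ⟨_, (x' 1).2⟩
  set d := Fintype.card b
  calc ENNReal.ofReal (upperDensity G J) * ENat.toENNReal (topDim P)
      ≤ ENNReal.ofReal (upperDensity G J) * d := by
        gcongr
        simpa using ENat.toENNReal_le.2 hdim
    _ = Filter.limsup (fun _ : ℕ => ENNReal.ofReal (upperDensity G J) * d) Filter.atTop :=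
        (Filter.limsup_const _).symm
    _ ≤ Filter.limsup (fun n => (Dcov X (FCover (fun c (x : G → ↥P) => shiftAct c x) (Fo n)
          (faceCover G e)) : ℝ≥0∞) / ((Fo n).card : ℝ≥0∞)) Filter.atTop := by
        refine Filter.limsup_le_limsup (Filter.Eventually.of_forall fun n => ?_)
        obtain ⟨g, hg⟩ := exists_translate_upperDensity_le hG J (hFo.1 n)
        have hD := card_mul_card_le_Dcov he hinj hXinv h (Fo n) g
        have hpos := (hFo.1 n).card_pos
        rw [ENNReal.le_div_iff_mul_le (Or.inl (by exact_mod_cast hpos.ne'))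
          (Or.inl (ENNReal.natCast_ne_top _)), mul_right_comm]
        have h1 : ENNReal.ofReal (upperDensity G J) * (Fo n).card ≤
            ((Fo n).filter fun f => f * g ∈ J).card := by
          rw [← ENNReal.ofReal_natCast (Fo n).card, ← ENNReal.ofReal_mul' (Nat.cast_nonneg _),
            ← ENNReal.ofReal_natCast ((Fo n).filter fun f => f * g ∈ J).card]
          exact ENNReal.ofReal_le_ofReal hg
        calc _ ≤ (((Fo n).filter fun f => f * g ∈ J).card : ℝ≥0∞) * d := by gcongr
          _ ≤ _ := by exact_mod_cast hD
    _ ≤ mdim (fun c (x : G → ↥P) => shiftAct c x) X Fo :=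
        le_iSup₂_of_le (faceCover G e) (isOpenCoverOf_faceCover he hinj X) le_rfl
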